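/- The harmonic components of an invariant homogeneous polynomial are invariant: let p be a homogeneous polynomial of degree d in n real variables, let A be an orthogonal n×n real matrix with p ∘ A = p, and let p = Σ_{j=0}^{⌊d/2⌋} q^j · h_j be a harmonic decomposition, i.e. each h_j is homogeneous of degree d − 2j and Δh_j = 0, where q = Σ_{i=1}^{n} x_i². Then h_j ∘ A = h_j for every j. -/

import Mathlib

open MvPolynomial Finset

/-- The polynomial Laplacian `Δp = ∑ i, ∂²p/∂xᵢ²`. -/
noncomputable def polyLaplacian {n : ℕ} (p : MvPolynomial (Fin n) ℝ) :
    MvPolynomial (Fin n) ℝ :=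
  ∑ i : Fin n, pderiv i (pderiv i p)

/-- The linear substitution `p ∘ A`, sending the variable `Xᵢ` to `∑ⱼ Aᵢⱼ Xⱼ`. -/
noncomputable def polySubst {n : ℕ} (A : Matrix (Fin n) (Fin n) ℝ)
    (p : MvPolynomial (Fin n) ℝ) : MvPolynomial (Fin n) ℝ :=
  aeval (fun i : Fin n => ∑ j : Fin n, C (A i j) * X j) p

namespace MvPolynomial

variable {n : ℕ}

theorem polyLaplacian_sum_sq_mul (f : MvPolynomial (Fin n) ℝ) :
    polyLaplacian ((∑ i : Fin n, X i ^ 2) * f) =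
      2 * (n : MvPolynomial (Fin n) ℝ) * f + 4 * ∑ i, X i * pderiv i f +
        (∑ i : Fin n, X i ^ 2) * polyLaplacian f := by
  have hq (i : Fin n) : pderiv i (∑ j : Fin n, (X j : MvPolynomial (Fin n) ℝ) ^ 2) = 2 * X i := by
    simp [Derivation.leibniz_pow, pderiv_X, Pi.single_apply]
  have h2 (i : Fin n) : pderiv i (2 * X i : MvPolynomial (Fin n) ℝ) = 2 := by
    have : (2 : MvPolynomial (Fin n) ℝ) = C 2 := (map_ofNat C 2).symm
    rw [this, pderiv_C_mul, pderiv_X_self, mul_one]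
  have key (i : Fin n) : pderiv i (pderiv i ((∑ j : Fin n, X j ^ 2) * f)) =
      2 * f + 4 * (X i * pderiv i f) + (∑ j : Fin n, X j ^ 2) * pderiv i (pderiv i f) := by
    rw [pderiv_mul, hq, map_add, pderiv_mul, h2, pderiv_mul, hq]
    ring
  simp only [polyLaplacian, key, Finset.sum_add_distrib, ← Finset.mul_sum]
  simp
  ring

theorem isHomogeneous_sum_sq :
    (∑ i : Fin n, (X i : MvPolynomial (Fin n) ℝ) ^ 2).IsHomogeneous 2 :=
  IsHomogeneous.sum _ _ _ fun i _ => isHomogeneous_X_pow i 2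

theorem polyLaplacian_sum_sq_pow_mul {g : MvPolynomial (Fin n) ℝ} {m : ℕ}
    (hg : g.IsHomogeneous m) (hΔ : polyLaplacian g = 0) (j : ℕ) :
    polyLaplacian ((∑ i : Fin n, X i ^ 2) ^ (j + 1) * g) =
      (∑ i : Fin n, X i ^ 2) ^ j *
        (((2 * (j + 1) * (n + 2 * m + 2 * j) : ℕ) : ℝ) • g) := by
  induction j with
  | zero =>
    rw [zero_add, pow_one, polyLaplacian_sum_sq_mul, hΔ, hg.sum_X_mul_pderiv]
    simp only [Nat.cast_smul_eq_nsmul, nsmul_eq_mul, pow_zero, mul_zero]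
    push_cast
    ring
  | succ j ih =>
    have hhom : ((∑ i : Fin n, X i ^ 2) ^ (j + 1) * g).IsHomogeneous (2 * (j + 1) + m) :=
      (isHomogeneous_sum_sq.pow (j + 1)).mul hg
    rw [pow_succ', mul_assoc, polyLaplacian_sum_sq_mul, ih, hhom.sum_X_mul_pderiv]
    simp only [Nat.cast_smul_eq_nsmul, nsmul_eq_mul]
    push_cast
    ring

theorem polyLaplacian_sum {ι : Type*} (s : Finset ι) (f : ι → MvPolynomial (Fin n) ℝ) :
    polyLaplacian (∑ i ∈ s, f i) = ∑ i ∈ s, polyLaplacian (f i) := by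
  simp only [polyLaplacian, map_sum]
  exact Finset.sum_comm

theorem polyLaplacian_smul (c : ℝ) (f : MvPolynomial (Fin n) ℝ) :
    polyLaplacian (c • f) = c • polyLaplacian f := by
  simp [polyLaplacian, Finset.smul_sum]

theorem polyLaplacian_sub (f g : MvPolynomial (Fin n) ℝ) :
    polyLaplacian (f - g) = polyLaplacian f - polyLaplacian g := by
  simp [polyLaplacian]

/-- Harmonic decompositions are unique. -/
theorem eq_zero_of_sum_sum_sq_pow_mul_eq_zero (hn : 1 ≤ n) (N : ℕ)
    (g : ℕ → MvPolynomial (Fin n) ℝ) (e : ℕ → ℕ)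
    (hhom : ∀ j < N, (g j).IsHomogeneous (e j)) (hharm : ∀ j < N, polyLaplacian (g j) = 0)
    (hsum : ∑ j ∈ range N, (∑ i : Fin n, X i ^ 2) ^ j * g j = 0) :
    ∀ j < N, g j = 0 := by
  induction N generalizing g e with
  | zero => simp
  | succ N ih =>
    have hsucc : ∀ j < N, g (j + 1) = 0 := by
      intro j hj
      have hc := ih
        (fun j => ((2 * (j + 1) * (n + 2 * e (j + 1) + 2 * j) : ℕ) : ℝ) • g (j + 1))
        (fun j => e (j + 1))
        (fun j hj => by
          simpa only [smul_eq_C_mul] using (hhom (j + 1) (by lia)).C_mul _)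
        (fun j hj => by rw [polyLaplacian_smul, hharm (j + 1) (by lia), smul_zero])
        (by
          have hΔ := congrArg polyLaplacian hsum
          rw [polyLaplacian_sum, Finset.sum_range_succ', pow_zero, one_mul,
            hharm 0 (by lia), add_zero] at hΔ
          refine (Finset.sum_congr rfl fun j hj => ?_).trans (hΔ.trans (by simp [polyLaplacian]))
          have hj := Finset.mem_range.mp hj
          exact (polyLaplacian_sum_sq_pow_mul (hhom (j + 1) (by lia))
            (hharm (j + 1) (by lia)) j).symm) j hj
      refine (smul_eq_zero.mp hc).resolve_left ?_
      have : 0 < n + 2 * e (j + 1) + 2 * j := by lia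
      positivity
    rintro (_ | j) hj
    · rw [Finset.sum_range_succ', Finset.sum_eq_zero] at hsum
      · simpa using hsum
      · intro j hj
        rw [hsucc j (Finset.mem_range.mp hj), mul_zero]
    · exact hsucc j (by lia)

theorem pderiv_polySubst (A : Matrix (Fin n) (Fin n) ℝ) (k : Fin n)
    (f : MvPolynomial (Fin n) ℝ) :
    pderiv k (polySubst A f) = ∑ i, C (A i k) * polySubst A (pderiv i f) := by
  unfold polySubst
  induction f using MvPolynomial.induction_on with
  | C a => simp
  | add f g hf hg => simp only [map_add, hf, hg, mul_add, Finset.sum_add_distrib]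
  | mul_X f l hf =>
    have hX : pderiv k (∑ j, C (A l j) * X j) = (C (A l k) : MvPolynomial (Fin n) ℝ) := by
      simp [pderiv_X, Pi.single_apply]
    simp only [map_mul, aeval_X, pderiv_mul, hf, hX, map_add, mul_add, Finset.sum_add_distrib,
      Finset.sum_mul, mul_assoc]
    congr 1
    rw [Finset.sum_eq_single l (fun i _ hi => by simp [pderiv_X_of_ne hi.symm]) (by simp)]
    simp [mul_comm]

theorem polyLaplacian_polySubst {A : Matrix (Fin n) (Fin n) ℝ}
    (hA : A ∈ Matrix.orthogonalGroup (Fin n) ℝ) (f : MvPolynomial (Fin n) ℝ) :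
    polyLaplacian (polySubst A f) = polySubst A (polyLaplacian f) := by
  have hAA (i l : Fin n) : ∑ k, A i k * A l k = if i = l then 1 else 0 := by
    simpa [Matrix.mul_apply, Matrix.one_apply, Matrix.star_eq_conjTranspose] using
      congrFun₂ ((Matrix.mem_orthogonalGroup_iff (Fin n) ℝ).mp hA) i l
  have hsum : polySubst A (polyLaplacian f) = ∑ i, polySubst A (pderiv i (pderiv i f)) := by
    simp [polyLaplacian, polySubst]
  calc polyLaplacian (polySubst A f)
      = ∑ k, ∑ i, ∑ l, C (A i k * A l k) * polySubst A (pderiv l (pderiv i f)) := by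
        simp only [polyLaplacian, pderiv_polySubst, map_sum, pderiv_C_mul, Finset.mul_sum,
          C_mul, mul_assoc]
    _ = ∑ i, ∑ l, C (∑ k, A i k * A l k) * polySubst A (pderiv l (pderiv i f)) := by
        rw [Finset.sum_comm]
        refine Finset.sum_congr rfl fun i _ => ?_
        rw [Finset.sum_comm]
        simp only [map_sum, Finset.sum_mul]
    _ = polySubst A (polyLaplacian f) := by
        simp [hAA, hsum, apply_ite, ite_mul]

theorem polySubst_sum_sq {A : Matrix (Fin n) (Fin n) ℝ}
    (hA : A ∈ Matrix.orthogonalGroup (Fin n) ℝ) :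
    polySubst A (∑ i : Fin n, X i ^ 2) = ∑ i : Fin n, X i ^ 2 := by
  have hAA (k l : Fin n) : ∑ i, A i k * A i l = if k = l then 1 else 0 := by
    simpa [Matrix.mul_apply, Matrix.one_apply, Matrix.star_eq_conjTranspose] using
      congrFun₂ ((Matrix.mem_orthogonalGroup_iff' (Fin n) ℝ).mp hA) k l
  calc polySubst A (∑ i : Fin n, X i ^ 2)
      = ∑ i, ∑ k, ∑ l, C (A i k * A i l) * (X k * X l) := by
        simp only [polySubst, map_sum, pow_two, map_mul, aeval_X, Finset.sum_mul_sum,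
          mul_mul_mul_comm]
    _ = ∑ k, ∑ l, C (∑ i, A i k * A i l) * (X k * X l) := by
        rw [Finset.sum_comm]
        refine Finset.sum_congr rfl fun k _ => ?_
        rw [Finset.sum_comm]
        simp only [map_sum, Finset.sum_mul]
    _ = ∑ i : Fin n, X i ^ 2 := by
        simp [hAA, apply_ite, ite_mul, pow_two]

theorem IsHomogeneous.polySubst {f : MvPolynomial (Fin n) ℝ} {m : ℕ} (hf : f.IsHomogeneous m)
    (A : Matrix (Fin n) (Fin n) ℝ) : (polySubst A f).IsHomogeneous m := by
  simpa [_root_.polySubst] using hf.aeval (n := 1) (fun i => ∑ j : Fin n, C (A i j) * X j)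
    fun i => IsHomogeneous.sum _ _ _ fun j _ => isHomogeneous_C_mul_X _ _

end MvPolynomial

/-- The harmonic components of an invariant homogeneous polynomial are invariant:
if `p` is homogeneous of degree `d`, `A` is orthogonal, `p ∘ A = p`, and
`p = ∑_{j=0}^{⌊d/2⌋} qʲ · hⱼ` is a harmonic decomposition, then `hⱼ ∘ A = hⱼ` for all `j`. -/
theorem harmonic_components_invariant (n d : ℕ) (hn : 1 ≤ n)
    (p : MvPolynomial (Fin n) ℝ) (hp : p.IsHomogeneous d)
    (A : Matrix (Fin n) (Fin n) ℝ) (hA : A ∈ Matrix.orthogonalGroup (Fin n) ℝ)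
    (hinv : polySubst A p = p)
    (h : ℕ → MvPolynomial (Fin n) ℝ)
    (hhom : ∀ j ≤ d / 2, (h j).IsHomogeneous (d - 2 * j))
    (hharm : ∀ j ≤ d / 2, polyLaplacian (h j) = 0)
    (hdecomp : p = ∑ j ∈ Finset.range (d / 2 + 1), (∑ i : Fin n, X i ^ 2) ^ j * h j) :
    ∀ j ≤ d / 2, polySubst A (h j) = h j := by
  have hsubst : polySubst A p =
      ∑ j ∈ Finset.range (d / 2 + 1), (∑ i : Fin n, X i ^ 2) ^ j * polySubst A (h j) := by
    conv_rhs => rw [← polySubst_sum_sq hA]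
    rw [hdecomp]
    simp only [polySubst, map_sum, map_mul, map_pow]
  have hzero := eq_zero_of_sum_sum_sq_pow_mul_eq_zero hn (d / 2 + 1)
    (fun j => polySubst A (h j) - h j) (fun j => d - 2 * j)
    (fun j hj => ((hhom j (by lia)).polySubst A).sub (hhom j (by lia)))
    (fun j hj => by
      rw [polyLaplacian_sub, polyLaplacian_polySubst hA, hharm j (by lia), polySubst, map_zero,
        sub_zero])
    (by simp only [mul_sub, Finset.sum_sub_distrib, ← hsubst, ← hdecomp, hinv, sub_self])
  exact fun j hj => sub_eq_zero.mp (hzero j (by lia))
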